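/- Existence and value of the conditional mean: let p1, p2 ∈ ℕ with p1, p2 ≥ 1, μ = (μ1, μ2) ∈ ℝ^{p1} × ℝ^{p2}, Σ a symmetric positive definite matrix on ℝ^{p1+p2} with blocks Σ11, Σ12, Σ21, Σ22, and ν > 0 with ν + p1 > 1. Then for every x1 ∈ ℝ^{p1}, the function x2 ↦ x2 · t_{p1+p2}((x1,x2); μ, Σ, ν)/t_{p1}(x1; μ1, Σ11, ν) is Bochner integrable over ℝ^{p2} and ∫_{ℝ^{p2}} x2 · [t_{p1+p2}((x1,x2); μ, Σ, ν)/t_{p1}(x1; μ1, Σ11, ν)] dx2 = μ_{2|1}(x1). In particular, all conditional means of the multivariate Cauchy distribution (ν = 1) exist and equal the linear regression function. -/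

import Mathlib

open MeasureTheory Matrix

/-- The multivariate t density with location `μ`, scale matrix `S`, and degrees of
freedom `ν`, on `ι → ℝ` with `p = Fintype.card ι`. -/
noncomputable def mvtPdf {ι : Type*} [Fintype ι] [DecidableEq ι]
    (μ : ι → ℝ) (S : Matrix ι ι ℝ) (ν : ℝ) (x : ι → ℝ) : ℝ :=
  Real.Gamma ((ν + Fintype.card ι) / 2) /
      (Real.Gamma (ν / 2) * (ν * Real.pi) ^ ((Fintype.card ι : ℝ) / 2) * Real.sqrt S.det) *
    (1 + ν⁻¹ * ((x - μ) ⬝ᵥ S⁻¹ *ᵥ (x - μ))) ^ (-(ν + Fintype.card ι) / 2)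

lemma mvt_gauss (p : ℕ) (t : ℝ) (ht : 0 < t) :
    Integrable (fun z : Fin p → ℝ => Real.exp (-t * (z ⬝ᵥ z))) ∧
    ∫ z : Fin p → ℝ, Real.exp (-t * (z ⬝ᵥ z)) = (Real.pi / t) ^ ((p : ℝ) / 2) := by
  have h : (fun z : Fin p → ℝ => Real.exp (-t * (z ⬝ᵥ z))) =
      fun z => ∏ i, (fun x : ℝ => Real.exp (-t * x ^ 2)) (z i) := by
    funext z
    rw [← Real.exp_sum, dotProduct, Finset.mul_sum]
    simp only [sq]
  rw [h]
  refine ⟨Integrable.fintype_prod (fun _ => integrable_exp_neg_mul_sq ht), ?_⟩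
  rw [integral_fintype_prod_volume_eq_pow (fun x : ℝ => Real.exp (-t * x ^ 2)), integral_gaussian, Real.sqrt_eq_rpow, Fintype.card_fin,
    ← Real.rpow_natCast, ← Real.rpow_mul (by positivity)]
  congr 1
  ring

lemma mvt_dot_nonneg {p : ℕ} (z : Fin p → ℝ) : 0 ≤ z ⬝ᵥ z :=
  Finset.sum_nonneg fun i _ => mul_self_nonneg (z i)

lemma mvt_radial (p : ℕ) (b s : ℝ) (hb : 0 < b) (hs : (p : ℝ) / 2 < s) :
    Integrable (fun z : Fin p → ℝ => (b + z ⬝ᵥ z) ^ (-s)) ∧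
    ∫ z : Fin p → ℝ, (b + z ⬝ᵥ z) ^ (-s) =
      b ^ ((p : ℝ) / 2 - s) * Real.pi ^ ((p : ℝ) / 2) * Real.Gamma (s - p / 2) / Real.Gamma s := by
  have hp : (0 : ℝ) ≤ (p : ℝ) / 2 := by positivity
  have hs0 : 0 < s := by linarith
  have hG : 0 < Real.Gamma s := Real.Gamma_pos_of_pos hs0
  let f : ℝ → (Fin p → ℝ) → ℝ := fun t z => t ^ (s - 1) * Real.exp (-((b + z ⬝ᵥ z) * t))
  have hfe : ∀ t z, f t z = (t ^ (s - 1) * Real.exp (-(b * t))) * Real.exp (-t * (z ⬝ᵥ z)) := by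
    intro t z
    simp only [f]
    rw [mul_assoc, ← Real.exp_add]
    congr 2
    ring
  have hin : ∀ t, 0 < t → ∫ z, f t z =
      Real.pi ^ ((p : ℝ) / 2) * (t ^ ((s - p / 2) - 1) * Real.exp (-(b * t))) := by
    intro t ht
    simp only [hfe]
    rw [integral_const_mul, (mvt_gauss p t ht).2, Real.div_rpow Real.pi_pos.le ht.le,
      show s - (p : ℝ) / 2 - 1 = (s - 1) - (p : ℝ) / 2 by ring, Real.rpow_sub ht (s - 1)]
    ring
  have hgi : IntegrableOn (fun t : ℝ => t ^ ((s - (p : ℝ) / 2) - 1) * Real.exp (-(b * t)))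
      (Set.Ioi 0) := by
    have := integrableOn_rpow_mul_exp_neg_mul_rpow (p := 1) (s := (s - (p : ℝ) / 2) - 1) (b := b)
      (by linarith) one_pos hb
    simpa using this
  have hF : Integrable (Function.uncurry f)
      ((volume.restrict (Set.Ioi (0 : ℝ))).prod (volume : Measure (Fin p → ℝ))) := by
    rw [integrable_prod_iff]
    · constructor
      · refine (ae_restrict_iff' measurableSet_Ioi).2 (ae_of_all _ fun t ht => ?_)
        simp only [Function.uncurry, hfe]
        exact (mvt_gauss p t ht).1.const_mul _
      · refine (IntegrableOn.congr_fun (hgi.const_mul (Real.pi ^ ((p : ℝ) / 2)))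
          (fun t ht => ?_) measurableSet_Ioi)
        simp only [Function.uncurry]
        rw [← hin t ht]
        refine integral_congr_ae (ae_of_all _ fun z => ?_)
        have ht' : 0 < t := ht
        have : 0 ≤ f t z := by simp only [f]; positivity
        simp only [Real.norm_of_nonneg this]
    · apply Measurable.aestronglyMeasurable
      simp only [f, Function.uncurry_def, dotProduct]
      fun_prop
  have hout : ∀ z : Fin p → ℝ, ∫ t in Set.Ioi (0 : ℝ), f t z =
      Real.Gamma s * (b + z ⬝ᵥ z) ^ (-s) := by
    intro z
    have hz : 0 < b + z ⬝ᵥ z := by have := mvt_dot_nonneg z; linarith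
    simp only [f]
    rw [Real.integral_rpow_mul_exp_neg_mul_Ioi hs0 hz, one_div, Real.inv_rpow hz.le,
      Real.rpow_neg hz.le]
    ring
  have e : (fun z : Fin p → ℝ => (b + z ⬝ᵥ z) ^ (-s)) =
      fun z => (Real.Gamma s)⁻¹ * ∫ t in Set.Ioi (0 : ℝ), f t z := by
    funext z
    rw [hout]
    field_simp
  rw [e]
  refine ⟨hF.integral_prod_right.const_mul _, ?_⟩
  rw [integral_const_mul, ← integral_integral_swap hF,
    setIntegral_congr_fun measurableSet_Ioi (fun t ht => hin t ht), integral_const_mul,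
    Real.integral_rpow_mul_exp_neg_mul_Ioi (by linarith) hb, one_div, Real.inv_rpow hb.le,
    ← Real.rpow_neg hb.le, neg_sub]
  field_simp

lemma mvt_radial_moment (p : ℕ) (b s : ℝ) (hb : 0 < b) (hs : (p : ℝ) / 2 < s - 1 / 2) :
    Integrable (fun z : Fin p → ℝ => (b + z ⬝ᵥ z) ^ (-s) • z) := by
  refine (mvt_radial p b (s - 1 / 2) hb hs).1.mono' ?_ (ae_of_all _ fun z => ?_)
  · apply Measurable.aestronglyMeasurable
    simp only [dotProduct]
    fun_prop
  · have hz := mvt_dot_nonneg z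
    have hz' : 0 < b + z ⬝ᵥ z := by linarith
    have h1 : ‖z‖ ≤ (b + z ⬝ᵥ z) ^ ((1 : ℝ) / 2) := by
      rw [← Real.sqrt_eq_rpow, pi_norm_le_iff_of_nonneg (Real.sqrt_nonneg _)]
      intro i
      rw [Real.norm_eq_abs]
      apply Real.abs_le_sqrt
      have : z i * z i ≤ z ⬝ᵥ z :=
        Finset.single_le_sum (f := fun i => z i * z i) (fun j _ => mul_self_nonneg (z j))
          (Finset.mem_univ i)
      nlinarith
    rw [norm_smul, Real.norm_of_nonneg (by positivity),
      show -(s - 1 / 2) = -s + 1 / 2 by ring, Real.rpow_add hz']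
    gcongr

lemma mvt_matrix_cov {p : ℕ} {E : Type*} [NormedAddCommGroup E] [NormedSpace ℝ E]
    (C : Matrix (Fin p) (Fin p) ℝ) (hC : C.det ≠ 0) (g : (Fin p → ℝ) → E) (hg : Integrable g) :
    Integrable (fun z => g (C *ᵥ z)) ∧ ∫ z, g (C *ᵥ z) = |C.det|⁻¹ • ∫ z, g z := by
  have hm := Real.map_matrix_volume_pi_eq_smul_volume_pi hC
  have hmeas : AEMeasurable (toLin' C) (volume : Measure (Fin p → ℝ)) :=
    (LinearMap.continuous_of_finiteDimensional (toLin' C)).aemeasurable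
  have hg' : Integrable g (Measure.map (toLin' C) volume) := by
    rw [hm]
    exact hg.smul_measure ENNReal.ofReal_ne_top
  have h1 := hg'.comp_aemeasurable hmeas
  have h2 := integral_map hmeas hg'.aestronglyMeasurable
  simp only [toLin'_apply] at h2
  refine ⟨by simpa [Function.comp_def] using h1, ?_⟩
  rw [← h2, hm, integral_smul_measure, ENNReal.toReal_ofReal (abs_nonneg _), abs_inv]

lemma mvt_quad (p : ℕ) (B : Matrix (Fin p) (Fin p) ℝ) (hB : B.PosDef) (b s : ℝ) (hb : 0 < b)
    (hs : (p : ℝ) / 2 < s - 1 / 2) :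
    Integrable (fun z : Fin p → ℝ => (b + z ⬝ᵥ B *ᵥ z) ^ (-s)) ∧
    Integrable (fun z : Fin p → ℝ => (b + z ⬝ᵥ B *ᵥ z) ^ (-s) • z) ∧
    ∫ z : Fin p → ℝ, (b + z ⬝ᵥ B *ᵥ z) ^ (-s) =
      (Real.sqrt B.det)⁻¹ * (b ^ ((p : ℝ) / 2 - s) * Real.pi ^ ((p : ℝ) / 2) *
        Real.Gamma (s - p / 2) / Real.Gamma s) := by
  obtain ⟨C, hC⟩ : ∃ C : Matrix (Fin p) (Fin p) ℝ, B = Cᵀ * C := by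
    open scoped MatrixOrder in
    obtain ⟨C, hC⟩ := CStarAlgebra.nonneg_iff_eq_star_mul_self.mp hB.posSemidef.nonneg
    exact ⟨C, by simpa [star_eq_conjTranspose] using hC⟩
  have hdet : B.det = C.det * C.det := by rw [hC, det_mul, det_transpose]
  have hC0 : C.det ≠ 0 := by
    intro h
    have := hB.det_pos
    rw [hdet, h] at this
    simp at this
  have hq : ∀ z, z ⬝ᵥ B *ᵥ z = (C *ᵥ z) ⬝ᵥ (C *ᵥ z) := by
    intro z
    rw [hC, ← mulVec_mulVec, dotProduct_mulVec, vecMul_transpose]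
  have hinv : ∀ z, C⁻¹ *ᵥ (C *ᵥ z) = z := by
    intro z
    rw [mulVec_mulVec, nonsing_inv_mul _ (isUnit_iff_ne_zero.2 hC0), one_mulVec]
  simp only [hq]
  obtain ⟨r1, r2⟩ := mvt_radial p b s hb (by linarith)
  obtain ⟨c1, c2⟩ := mvt_matrix_cov C hC0 _ r1
  refine ⟨c1, ?_, ?_⟩
  · have m1 := mvt_radial_moment p b s hb hs
    have m2 := (LinearMap.toContinuousLinearMap (toLin' C⁻¹)).integrable_comp m1
    have := (mvt_matrix_cov C hC0 _ m2).1
    simpa [hinv, mulVec_smul] using this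
  · rw [c2, r2, hdet, Real.sqrt_mul_self_eq_abs, smul_eq_mul]

lemma mvt_block_quad {p1 p2 : ℕ}
    (S11 : Matrix (Fin p1) (Fin p1) ℝ) (S12 : Matrix (Fin p1) (Fin p2) ℝ)
    (S21 : Matrix (Fin p2) (Fin p1) ℝ) (S22 : Matrix (Fin p2) (Fin p2) ℝ)
    (hS : (Matrix.fromBlocks S11 S12 S21 S22).PosDef) :
    S11.PosDef ∧ ∃ A : Matrix (Fin p2) (Fin p2) ℝ, A.PosDef ∧
      (Matrix.fromBlocks S11 S12 S21 S22).det = S11.det * A.det ∧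
      ∀ u w, Sum.elim u w ⬝ᵥ (Matrix.fromBlocks S11 S12 S21 S22)⁻¹ *ᵥ Sum.elim u w =
        u ⬝ᵥ S11⁻¹ *ᵥ u + (w - S21 *ᵥ (S11⁻¹ *ᵥ u)) ⬝ᵥ A⁻¹ *ᵥ (w - S21 *ᵥ (S11⁻¹ *ᵥ u)) := by
  have h11 : S11.PosDef := hS.submatrix (e := Sum.inl) Sum.inl_injective
  have hH := hS.isHermitian
  rw [isHermitian_fromBlocks_iff] at hH
  obtain ⟨hH1, hH2, hH3, hH4⟩ := hH
  simp only [conjTranspose_eq_transpose_of_trivial] at hH2 hH3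
  have h11t : S11ᵀ = S11 := by simpa using hH1.eq
  let i11 : Invertible S11 := h11.isUnit.invertible
  have hdet : (Matrix.fromBlocks S11 S12 S21 S22).det =
      S11.det * (S22 - S21 * S11⁻¹ * S12).det := by
    rw [det_fromBlocks₁₁, invOf_eq_nonsing_inv]
  have hpsd : (S22 - S21 * S11⁻¹ * S12).PosSemidef := by
    have := (Matrix.PosDef.fromBlocks₁₁ S12 S22 h11).1 (by
      simpa [hH2] using hS.posSemidef)
    simpa [hH2] using this
  have hA : (S22 - S21 * S11⁻¹ * S12).PosDef := by
    rw [hpsd.posDef_iff_det_ne_zero]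
    intro h
    have := hS.det_pos
    rw [hdet, h] at this
    simp at this
  refine ⟨h11, _, hA, hdet, fun u w => ?_⟩
  set A := S22 - S21 * S11⁻¹ * S12 with hAdef
  set d := w - S21 *ᵥ (S11⁻¹ *ᵥ u) with hd
  set β := A⁻¹ *ᵥ d with hβ
  have hAβ : A *ᵥ β = d := by
    rw [hβ, mulVec_mulVec, mul_nonsing_inv _ (isUnit_iff_ne_zero.2 hA.det_pos.ne'), one_mulVec]
  have e11 : ∀ v, S11 *ᵥ (S11⁻¹ *ᵥ v) = v := by
    intro v
    rw [mulVec_mulVec, mul_nonsing_inv _ (isUnit_iff_ne_zero.2 h11.det_pos.ne'), one_mulVec]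
  have hsol : (Matrix.fromBlocks S11 S12 S21 S22)⁻¹ *ᵥ Sum.elim u w =
      Sum.elim (S11⁻¹ *ᵥ (u - S12 *ᵥ β)) β := by
    have : Sum.elim u w = (Matrix.fromBlocks S11 S12 S21 S22) *ᵥ
        Sum.elim (S11⁻¹ *ᵥ (u - S12 *ᵥ β)) β := by
      rw [fromBlocks_mulVec]
      congr 1
      · simp [e11]
      · have h2 : S22 *ᵥ β = d + S21 *ᵥ (S11⁻¹ *ᵥ (S12 *ᵥ β)) := by
          rw [← hAβ, hAdef, sub_mulVec]
          simp [mulVec_mulVec, Matrix.mul_assoc]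
        simp only [Sum.elim_comp_inl, Sum.elim_comp_inr]
        rw [h2, mulVec_sub, mulVec_sub, hd]
        abel
    rw [this, mulVec_mulVec, nonsing_inv_mul _ (isUnit_iff_ne_zero.2 hS.det_pos.ne'), one_mulVec]
  have hsym : u ⬝ᵥ S11⁻¹ *ᵥ (S12 *ᵥ β) = (S21 *ᵥ (S11⁻¹ *ᵥ u)) ⬝ᵥ β := by
    rw [dotProduct_mulVec, dotProduct_mulVec, ← vecMul_transpose, ← vecMul_transpose,
      transpose_nonsing_inv, h11t, ← hH2, transpose_transpose]
  rw [hsol, sumElim_dotProduct_sumElim, mulVec_sub, dotProduct_sub, hsym, hd, sub_dotProduct]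
  ring

/-- Existence and value of the conditional mean of the multivariate t distribution: when
`ν + p₁ > 1`, the function `x₂ ↦ x₂ · t_{p1+p2}((x₁,x₂); μ, Σ, ν)/t_{p1}(x₁; μ₁, Σ₁₁, ν)`
is Bochner integrable and its integral equals the linear regression function
`μ_{2|1}(x₁) = μ₂ + Σ₂₁Σ₁₁⁻¹(x₁ − μ₁)`. -/
theorem mvt_conditional_mean (p1 p2 : ℕ) (hp1 : 1 ≤ p1) (hp2 : 1 ≤ p2)
    (μ1 : Fin p1 → ℝ) (μ2 : Fin p2 → ℝ)
    (S11 : Matrix (Fin p1) (Fin p1) ℝ) (S12 : Matrix (Fin p1) (Fin p2) ℝ)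
    (S21 : Matrix (Fin p2) (Fin p1) ℝ) (S22 : Matrix (Fin p2) (Fin p2) ℝ)
    (hS : (Matrix.fromBlocks S11 S12 S21 S22).PosDef) (ν : ℝ) (hν : 0 < ν)
    (hν1 : 1 < ν + p1) (x1 : Fin p1 → ℝ) :
    Integrable (fun x2 : Fin p2 → ℝ =>
        (mvtPdf (Sum.elim μ1 μ2) (Matrix.fromBlocks S11 S12 S21 S22) ν (Sum.elim x1 x2) /
            mvtPdf μ1 S11 ν x1) • x2) ∧
      ∫ x2 : Fin p2 → ℝ,
          (mvtPdf (Sum.elim μ1 μ2) (Matrix.fromBlocks S11 S12 S21 S22) ν (Sum.elim x1 x2) /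
              mvtPdf μ1 S11 ν x1) • x2
        = μ2 + S21 *ᵥ (S11⁻¹ *ᵥ (x1 - μ1)) := by
  obtain ⟨h11, A, hA, hdet, hquad⟩ := mvt_block_quad S11 S12 S21 S22 hS
  set m := μ2 + S21 *ᵥ (S11⁻¹ *ᵥ (x1 - μ1)) with hm
  set b : ℝ := 1 + ν⁻¹ * ((x1 - μ1) ⬝ᵥ S11⁻¹ *ᵥ (x1 - μ1)) with hbdef
  have hb : 0 < b := by
    have h := h11.inv.posSemidef.dotProduct_mulVec_nonneg (x1 - μ1)
    simp only [star_trivial] at h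
    positivity
  set B := ν⁻¹ • A⁻¹ with hBdef
  have hB : B.PosDef := hA.inv.smul (by positivity)
  set s : ℝ := (ν + (p1 + p2)) / 2 with hs
  obtain ⟨i1, i2, i3⟩ := mvt_quad p2 B hB b s hb (by rw [hs]; linarith)
  set K : ℝ := Real.Gamma s / (Real.Gamma (ν / 2) * (ν * Real.pi) ^ (((p1 : ℝ) + p2) / 2) *
      Real.sqrt (S11.det * A.det)) / (mvtPdf μ1 S11 ν x1) with hK
  set g : (Fin p2 → ℝ) → ℝ := fun z => K * (b + z ⬝ᵥ B *ᵥ z) ^ (-s) with hg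
  have hratio : ∀ x2 : Fin p2 → ℝ,
      mvtPdf (Sum.elim μ1 μ2) (Matrix.fromBlocks S11 S12 S21 S22) ν (Sum.elim x1 x2) /
        mvtPdf μ1 S11 ν x1 = g (x2 - m) := by
    intro x2
    have hsub : Sum.elim x1 x2 - Sum.elim μ1 μ2 = Sum.elim (x1 - μ1) (x2 - μ2) := by
      ext (i | i) <;> simp
    have h1 : x2 - μ2 - S21 *ᵥ (S11⁻¹ *ᵥ (x1 - μ1)) = x2 - m := by rw [hm]; abel
    have h2 : b + (x2 - m) ⬝ᵥ B *ᵥ (x2 - m) =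
        1 + ν⁻¹ * ((x1 - μ1) ⬝ᵥ S11⁻¹ *ᵥ (x1 - μ1) + (x2 - m) ⬝ᵥ A⁻¹ *ᵥ (x2 - m)) := by
      rw [hBdef, hbdef, smul_mulVec, dotProduct_smul, smul_eq_mul]
      ring
    simp only [hg]
    rw [hK, h2]
    conv_lhs => rw [mvtPdf]
    rw [hsub, hquad, h1, hdet, Fintype.card_sum, Fintype.card_fin, Fintype.card_fin,
      Nat.cast_add, ← hs, neg_div, ← hs]
    ring
  have hnorm : ∫ z, g z = 1 := by
    simp only [hg]
    rw [integral_const_mul, i3]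
    have hd1 := h11.det_pos
    have hd2 := hA.det_pos
    have hG1 : 0 < Real.Gamma s := Real.Gamma_pos_of_pos (by rw [hs]; positivity)
    have hG2 : 0 < Real.Gamma (ν / 2) := Real.Gamma_pos_of_pos (by positivity)
    have hG3 : 0 < Real.Gamma ((ν + p1) / 2) := Real.Gamma_pos_of_pos (by positivity)
    have hBd : (Real.sqrt B.det)⁻¹ = ν ^ ((p2 : ℝ) / 2) * Real.sqrt A.det := by
      rw [hBdef, det_smul, Fintype.card_fin, det_nonsing_inv, Ring.inverse_eq_inv', inv_pow,
        ← mul_inv, Real.sqrt_inv, inv_inv, Real.sqrt_mul (by positivity), Real.sqrt_eq_rpow,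
        ← Real.rpow_natCast, ← Real.rpow_mul hν.le, mul_one_div]
    have e1 : s - (p2 : ℝ) / 2 = (ν + p1) / 2 := by rw [hs]; ring
    have e2 : (p2 : ℝ) / 2 - s = -(ν + p1) / 2 := by rw [hs]; ring
    rw [hK, hBd, e1, e2, mvtPdf, Fintype.card_fin, ← hbdef, Real.sqrt_mul hd1.le, add_div,
      Real.rpow_add (by positivity), Real.mul_rpow hν.le Real.pi_pos.le (z := (p2 : ℝ) / 2)]
    have := Real.sqrt_pos.2 hd1
    have := Real.sqrt_pos.2 hd2
    have := Real.rpow_pos_of_pos hb (-(ν + p1) / 2)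
    have : 0 < (ν * Real.pi) ^ ((p1 : ℝ) / 2) := by positivity
    have : 0 < ν ^ ((p2 : ℝ) / 2) := by positivity
    have : 0 < Real.pi ^ ((p2 : ℝ) / 2) := by positivity
    rw [← hbdef] at *
    generalize b ^ (-(ν + (p1 : ℝ)) / 2) = c1 at *
    generalize (ν * Real.pi) ^ ((p1 : ℝ) / 2) = c2 at *
    generalize ν ^ ((p2 : ℝ) / 2) = c3 at *
    generalize Real.pi ^ ((p2 : ℝ) / 2) = c4 at *
    generalize Real.Gamma ((ν + (p1 : ℝ)) / 2) = c5 at *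
    field_simp
  have hgi : Integrable g := i1.const_mul K
  have hgzi : Integrable (fun z => g z • z) := by
    refine (i2.smul K).congr (ae_of_all _ fun z => ?_)
    simp only [hg, Pi.smul_apply, smul_smul]
  have hodd : ∫ z, g z • z = 0 := by
    have h := integral_neg_eq_self (fun z : Fin p2 → ℝ => g z • z) volume
    have h' : ∀ z, g (-z) • (-z) = -(g z • z) := by
      intro z
      simp [hg, mulVec_neg]
    simp only [h', integral_neg] at h
    exact self_eq_neg.1 h.symm
  have hsum : Integrable (fun z => g z • (z + m)) := by
    refine (hgzi.add (hgi.smul_const m)).congr (ae_of_all _ fun z => ?_)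
    simp only [Pi.add_apply, smul_add]
  have heq : (fun x2 : Fin p2 → ℝ =>
        (mvtPdf (Sum.elim μ1 μ2) (Matrix.fromBlocks S11 S12 S21 S22) ν (Sum.elim x1 x2) /
            mvtPdf μ1 S11 ν x1) • x2) =
      fun x2 => (fun z => g z • (z + m)) (x2 - m) := by
    funext x2
    simp only [hratio, sub_add_cancel]
  rw [heq]
  refine ⟨hsum.comp_sub_right m, ?_⟩
  rw [integral_sub_right_eq_self (fun z => g z • (z + m)) m]
  simp only [smul_add]
  rw [integral_add hgzi (hgi.smul_const m), hodd, integral_smul_const, hnorm, one_smul, zero_add]
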